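/- arXiv:2508.13289 — 3 statements merged into one kernel-verified Lean document; each statement's English description precedes it below -/
import Mathlib

section
/- An n-correct set X in ℝ² has exactly n+1 maximal lines if and only if X is a Carnicer–Gasca set of degree n, that is, there exist n+1 lines ℓ_0,…,ℓ_n in general position (no two parallel, no three concurrent) and points A_i ∈ ℓ_i for i = 0,…,n, with each A_i lying on no ℓ_j for j ≠ i and the n+1 points A_0,…,A_n not all collinear, such that X = {A_{ij} : 0 ≤ i < j ≤ n} ∪ {A_0,…,A_n}, where A_{ij} = ℓ_i ∩ ℓ_j. -/
open MvPolynomial Finset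
open scoped Classical BigOperators

noncomputable section

/-- Points of the plane. -/
abbrev Pt : Type := Fin 2 → ℝ

/-- Bivariate real polynomials. -/
abbrev Poly2 : Type := MvPolynomial (Fin 2) ℝ

/-- `N = dim Π_n = (n+1)(n+2)/2`. -/
def Nn (n : ℕ) : ℕ := (n + 1) * (n + 2) / 2

/-- `X` is an `n`-correct set of nodes: it has `N` nodes and the only polynomial of total
degree at most `n` vanishing at all of them is the zero polynomial. -/
def IsNCorrect (n : ℕ) (X : Finset Pt) : Prop :=
  X.card = Nn n ∧
  ∀ p : Poly2, p.totalDegree ≤ n → (∀ P ∈ X, eval P p = 0) → p = 0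

/-- A line: a (nonzero) polynomial of total degree exactly 1. -/
def IsLine (ℓ : Poly2) : Prop := ℓ.totalDegree = 1

/-- The zero set of a polynomial, as a subset of the plane. -/
def zeroSet (q : Poly2) : Set Pt := {P : Pt | eval P q = 0}

/-- `X ∩ q` : the nodes of `X` lying on the curve `q`. -/
def zerosIn (X : Finset Pt) (q : Poly2) : Finset Pt := X.filter fun P => eval P q = 0

/-- `X \ q` : the nodes of `X` not lying on the curve `q`. -/
def nonzerosIn (X : Finset Pt) (q : Poly2) : Finset Pt := X.filter fun P => eval P q ≠ 0

/-- `ℓ` is a maximal line for (an `n`-correct set) `X`: a line passing through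
exactly `n+1` nodes. -/
def IsMaximalLine (n : ℕ) (X : Finset Pt) (ℓ : Poly2) : Prop :=
  IsLine ℓ ∧ (zerosIn X ℓ).card = n + 1

/-- The collection of maximal lines of `X` (as subsets of the plane). -/
def maximalLines (n : ℕ) (X : Finset Pt) : Set (Set Pt) :=
  {Z : Set Pt | ∃ ℓ : Poly2, IsMaximalLine n X ℓ ∧ Z = zeroSet ℓ}

/-- `p` is the `n`-fundamental polynomial of the node `A` of `X`. -/
def IsFund (n : ℕ) (X : Finset Pt) (A : Pt) (p : Poly2) : Prop :=
  p.totalDegree ≤ n ∧ eval A p = 1 ∧ ∀ P ∈ X, P ≠ A → eval P p = 0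

/-- The node `A` of `X` uses the curve `q`: `q` divides the fundamental polynomial of `A`. -/
def Uses (n : ℕ) (X : Finset Pt) (A : Pt) (q : Poly2) : Prop :=
  ∃ p : Poly2, IsFund n X A p ∧ q ∣ p

/-- `d(n,k) = k(2n+3-k)/2`. -/
def d (n k : ℕ) : ℕ := k * (2 * n + 3 - k) / 2

/-- `q` is a maximal curve of degree `k` for `X`: it passes through exactly `d(n,k)` nodes. -/
def IsMaximalCurve (n k : ℕ) (X : Finset Pt) (q : Poly2) : Prop :=
  q.totalDegree = k ∧ (zerosIn X q).card = d n k

/-- `{A,B,C}` is a special triplet of the `n`-correct set `X` : there is a maximal curve `f`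
of degree `n-1` with `X \ f = {A,B,C}`. -/
def IsSpecialTriplet (n : ℕ) (X : Finset Pt) (A B C : Pt) : Prop :=
  A ∈ X ∧ B ∈ X ∧ C ∈ X ∧ A ≠ B ∧ A ≠ C ∧ B ≠ C ∧
  ∃ f : Poly2, IsMaximalCurve n (n - 1) X f ∧ nonzerosIn X f = {A, B, C}

/-- `X` is a `GC_n` set: an `n`-correct set in which every fundamental polynomial is a
product of `n` linear factors. -/
def IsGC (n : ℕ) (X : Finset Pt) : Prop :=
  IsNCorrect n X ∧
  ∀ A ∈ X, ∃ p : Poly2, IsFund n X A p ∧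
    ∃ g : Fin n → Poly2, (∀ i, (g i).totalDegree = 1) ∧ p = ∏ i, g i

/-- `ℓ` is a line passing through the points `P` and `Q` (in particular, `ℓ_{PQ}` when
`P ≠ Q`). -/
def IsLineThrough (ℓ : Poly2) (P Q : Pt) : Prop :=
  IsLine ℓ ∧ eval P ℓ = 0 ∧ eval Q ℓ = 0

/-- `ℓ` is a `2`-node line of `X` passing through exactly the two nodes `A` and `B`. -/
def IsTwoNodeLineOf (X : Finset Pt) (ℓ : Poly2) (A B : Pt) : Prop :=
  IsLine ℓ ∧ A ≠ B ∧ zerosIn X ℓ = {A, B}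

/-- `Y` is an `n`-independent set: every point has an `n`-fundamental polynomial. -/
def IsNIndependent (n : ℕ) (Y : Finset Pt) : Prop :=
  ∀ A ∈ Y, ∃ p : Poly2, p.totalDegree ≤ n ∧ eval A p ≠ 0 ∧
    ∀ P ∈ Y, P ≠ A → eval P p = 0

/-- A family of lines is in general position: no two parallel (or equal) — i.e. any two of
them meet in a unique point — and no three concurrent. -/
def GenPos {m : ℕ} (ℓ : Fin m → Poly2) : Prop :=
  (∀ i, IsLine (ℓ i)) ∧
  (∀ i j, i ≠ j → ∃! P : Pt, eval P (ℓ i) = 0 ∧ eval P (ℓ j) = 0) ∧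
  (∀ i j k, i ≠ j → i ≠ k → j ≠ k →
    ¬∃ P : Pt, eval P (ℓ i) = 0 ∧ eval P (ℓ j) = 0 ∧ eval P (ℓ k) = 0)

/-- `X` is a Chung–Yao set of degree `n`: the set of pairwise intersection points of `n+2`
lines in general position. -/
def IsChungYao (n : ℕ) (X : Finset Pt) : Prop :=
  ∃ ℓ : Fin (n + 2) → Poly2, GenPos ℓ ∧
    (↑X : Set Pt) = {P : Pt | ∃ i j, i ≠ j ∧ eval P (ℓ i) = 0 ∧ eval P (ℓ j) = 0}

/-- `X` is a Carnicer–Gasca set of degree `n`: the pairwise intersection points of `n+1`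
lines in general position together with one extra point `A i` on each line `ℓ i`, the `A i`
lying on no other line of the family and not all collinear. -/
def IsCarnicerGasca (n : ℕ) (X : Finset Pt) : Prop :=
  ∃ (ℓ : Fin (n + 1) → Poly2) (A : Fin (n + 1) → Pt), GenPos ℓ ∧
    (∀ i j, eval (A i) (ℓ j) = 0 ↔ j = i) ∧
    (¬∃ L : Poly2, IsLine L ∧ ∀ i, eval (A i) L = 0) ∧
    (↑X : Set Pt) =
      {P : Pt | ∃ i j, i ≠ j ∧ eval P (ℓ i) = 0 ∧ eval P (ℓ j) = 0} ∪ Set.range A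

/-- The node counts of consecutive degrees differ by the number of nodes of a maximal line. -/
lemma Nn_succ (m : ℕ) : Nn (m + 1) = Nn m + (m + 2) := by
  unfold Nn
  have h : (m + 1 + 1) * (m + 1 + 2) = (m + 1) * (m + 2) + (m + 2) * 2 := by ring
  rw [h, Nat.add_mul_div_right _ _ two_pos]

lemma card_sigma_antidiagonal (m : ℕ) :
    ((range (m + 1)).sigma fun k => antidiagonal k).card = Nn m := by
  rw [card_sigma]
  induction m with
  | zero => simp [Nn]
  | succ m ih => rw [sum_range_succ, ih, Nn_succ, Nat.card_antidiagonal]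

/-- Fewer than `dim Π_m` points always lie on a curve of degree at most `m`. -/
lemma exists_ne_zero_vanishing {m : ℕ} {S : Finset Pt} (hS : S.card < Nn m) :
    ∃ q : Poly2, q ≠ 0 ∧ q.totalDegree ≤ m ∧ ∀ P ∈ S, eval P q = 0 := by
  set T := (range (m + 1)).sigma fun k => antidiagonal k with hT
  let e : T → (Fin 2 →₀ ℕ) := fun x => Finsupp.single 0 x.1.2.1 + Finsupp.single 1 x.1.2.2
  have he : Function.Injective e := by
    rintro ⟨⟨k, i, j⟩, hx⟩ ⟨⟨k', i', j'⟩, hy⟩ h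
    have h0 := DFunLike.congr_fun h 0
    have h1 := DFunLike.congr_fun h 1
    simp [e] at h0 h1
    simp [hT] at hx hy
    obtain ⟨-, rfl⟩ := hx
    obtain ⟨-, rfl⟩ := hy
    subst h0 h1
    rfl
  let f : (T → ℝ) →ₗ[ℝ] Poly2 := Fintype.linearCombination ℝ fun x => monomial (e x) (1 : ℝ)
  have hf : ∀ c, f c = ∑ x, monomial (e x) (c x) := by
    intro c
    simp [f, Fintype.linearCombination_apply, smul_monomial]
  let g : (T → ℝ) →ₗ[ℝ] (S → ℝ) := LinearMap.pi fun P => (aeval (P : Pt)).toLinearMap ∘ₗ f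
  have hrank : Module.finrank ℝ (S → ℝ) < Module.finrank ℝ (T → ℝ) := by
    rw [Module.finrank_fintype_fun_eq_card, Module.finrank_fintype_fun_eq_card, Fintype.card_coe,
      Fintype.card_coe, hT, card_sigma_antidiagonal]
    exact hS
  obtain ⟨c, hc, hc0⟩ := Submodule.exists_mem_ne_zero_of_ne_bot
    (LinearMap.ker_ne_bot_of_finrank_lt (f := g) hrank)
  refine ⟨f c, ?_, ?_, ?_⟩
  · intro h
    apply hc0
    funext x
    have := congrArg (coeff (e x)) h
    rw [hf, coeff_sum] at this
    simpa [coeff_monomial, he.eq_iff] using this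
  · rw [hf]
    refine totalDegree_finsetSum_le fun x _ => (totalDegree_monomial_le _ _).trans ?_
    obtain ⟨⟨k, i, j⟩, hx⟩ := x
    simp [hT] at hx
    have : ((Finsupp.single 0 i + Finsupp.single 1 j : Fin 2 →₀ ℕ).sum fun _ => id) = i + j := by
      rw [Finsupp.sum_add_index'] <;> simp
    simp only [e]
    omega
  · intro P hP
    have := congrFun (LinearMap.mem_ker.1 hc) ⟨P, hP⟩
    simpa [g, aeval_eq_eval] using this

lemma IsLine.ne_zero {ℓ : Poly2} (h : IsLine ℓ) : ℓ ≠ 0 := by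
  rintro rfl
  simp [IsLine] at h

lemma isLine_X_sub_C (i : Fin 2) (c : ℝ) : IsLine (X i - C c) := by
  refine le_antisymm ((totalDegree_sub_C_le _ _).trans (totalDegree_X i).le) ?_
  by_contra! h
  have h0 : (X i - C c : Poly2).totalDegree = 0 := by omega
  have hX := totalDegree_eq_zero_iff_eq_C.1 h0
  have := congrArg (eval fun _ => (0 : ℝ)) hX
  have h' := congrArg (eval fun _ => (1 : ℝ)) hX
  simp at this h'

/-- A line is the zero set of a nonconstant affine function. -/
lemma IsLine.exists_eval_eq {ℓ : Poly2} (h : IsLine ℓ) :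
    ∃ a b c : ℝ, (a ≠ 0 ∨ b ≠ 0) ∧ ∀ P, eval P ℓ = a * P 0 + b * P 1 + c := by
  have hform : ℓ = C (coeff (Finsupp.single 0 1) ℓ) * X 0 + C (coeff (Finsupp.single 1 1) ℓ) * X 1
      + C (coeff 0 ℓ) := by
    ext m
    by_cases hm : 1 < m.degree
    · have h1 : ℓ.totalDegree < ∑ i ∈ m.support, m i := by
        rw [show ℓ.totalDegree = 1 from h]; exact hm
      rw [coeff_eq_zero_of_totalDegree_lt h1]
      have h2 : (0 : Fin 2 →₀ ℕ) ≠ m := by rintro rfl; simp at hm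
      have h3 : ∀ i, (Finsupp.single i 1 : Fin 2 →₀ ℕ) ≠ m := by rintro i rfl; simp at hm
      simp [coeff_C, coeff_C_mul, coeff_X, h2, h3]
    · have hd : m.degree = m 0 + m 1 := by simp [Finsupp.degree_eq_sum]
      have h01 : m = 0 ∨ m = Finsupp.single 0 1 ∨ m = Finsupp.single 1 1 := by
        have : (m 0 = 0 ∧ m 1 = 0) ∨ (m 0 = 1 ∧ m 1 = 0) ∨ (m 0 = 0 ∧ m 1 = 1) := by omega
        rcases this with ⟨u, v⟩ | ⟨u, v⟩ | ⟨u, v⟩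
        · left; ext i; fin_cases i <;> simp [u, v]
        · right; left; ext i; fin_cases i <;> simp [u, v]
        · right; right; ext i; fin_cases i <;> simp [u, v]
      have h3 : ∀ i, (0 : Fin 2 →₀ ℕ) ≠ Finsupp.single i 1 := fun i =>
        (Finsupp.single_ne_zero.2 one_ne_zero).symm
      rcases h01 with rfl | rfl | rfl <;>
        simp [coeff_C, coeff_C_mul, coeff_X, Finsupp.single_left_inj, h3]
  have heval : ∀ P, eval P ℓ = coeff (Finsupp.single 0 1) ℓ * P 0
      + coeff (Finsupp.single 1 1) ℓ * P 1 + coeff 0 ℓ := fun P => by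
    conv_lhs => rw [hform]
    simp
  refine ⟨_, _, _, ?_, heval⟩
  by_contra! h0
  rw [h0.1, h0.2] at hform
  have : ℓ.totalDegree = 0 := by rw [hform]; simp
  rw [show ℓ.totalDegree = 1 from h] at this
  exact one_ne_zero this

lemma IsLine.zeroSet_subset {ℓ ℓ' : Poly2} (h : IsLine ℓ) (h' : IsLine ℓ') {P Q : Pt} (hPQ : P ≠ Q)
    (hP : eval P ℓ = 0) (hQ : eval Q ℓ = 0) (hP' : eval P ℓ' = 0) (hQ' : eval Q ℓ' = 0) :
    zeroSet ℓ ⊆ zeroSet ℓ' := by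
  intro R (hR : eval R ℓ = 0)
  change eval R ℓ' = 0
  obtain ⟨a, b, c, hab, hℓ⟩ := h.exists_eval_eq
  obtain ⟨a', b', c', -, hℓ'⟩ := h'.exists_eval_eq
  rw [hℓ] at hP hQ hR
  rw [hℓ'] at hP' hQ' ⊢
  have hdet : (R 0 - P 0) * (Q 1 - P 1) = (R 1 - P 1) * (Q 0 - P 0) := by
    rcases hab with ha | hb
    · apply mul_left_cancel₀ ha
      linear_combination (Q 1 - P 1) * (hR - hP) - (R 1 - P 1) * (hQ - hP)
    · apply mul_left_cancel₀ hb
      linear_combination (R 0 - P 0) * (hQ - hP) - (Q 0 - P 0) * (hR - hP)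
  have hne : Q 0 - P 0 ≠ 0 ∨ Q 1 - P 1 ≠ 0 := by
    by_contra! h0
    apply hPQ
    ext i
    fin_cases i
    · simpa using (sub_eq_zero.1 h0.1).symm
    · simpa using (sub_eq_zero.1 h0.2).symm
  rcases hne with h0 | h1
  · apply (mul_eq_zero.1 (?_ : (Q 0 - P 0) * _ = 0)).resolve_left h0
    linear_combination (R 0 - P 0) * (hQ' - hP') + (Q 0 - P 0) * hP' - b' * hdet
  · apply (mul_eq_zero.1 (?_ : (Q 1 - P 1) * _ = 0)).resolve_left h1
    linear_combination (R 1 - P 1) * (hQ' - hP') + (Q 1 - P 1) * hP' + a' * hdet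

/-- Two different lines have at most one common point. -/
lemma IsLine.eq_of_zeroSet_ne {ℓ ℓ' : Poly2} (h : IsLine ℓ) (h' : IsLine ℓ')
    (hne : zeroSet ℓ ≠ zeroSet ℓ') {P Q : Pt}
    (hP : eval P ℓ = 0) (hP' : eval P ℓ' = 0) (hQ : eval Q ℓ = 0) (hQ' : eval Q ℓ' = 0) :
    P = Q := by
  by_contra hPQ
  exact hne ((h.zeroSet_subset h' hPQ hP hQ hP' hQ').antisymm
    (h'.zeroSet_subset h hPQ hP' hQ' hP hQ))

lemma mem_zerosIn {X : Finset Pt} {q : Poly2} {P : Pt} :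
    P ∈ zerosIn X q ↔ P ∈ X ∧ eval P q = 0 := by simp [zerosIn]

lemma mem_nonzerosIn {X : Finset Pt} {q : Poly2} {P : Pt} :
    P ∈ nonzerosIn X q ↔ P ∈ X ∧ eval P q ≠ 0 := by simp [nonzerosIn]

lemma card_zerosIn_add_card_nonzerosIn (X : Finset Pt) (q : Poly2) :
    (zerosIn X q).card + (nonzerosIn X q).card = X.card :=
  card_filter_add_card_filter_not _

/-- A polynomial of degree at most `m` vanishing at the nodes off a line is zero. -/
lemma IsNCorrect.eq_zero_of_nonzerosIn {m : ℕ} {X : Finset Pt} (hX : IsNCorrect (m + 1) X)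
    {ℓ q : Poly2} (hℓ : IsLine ℓ) (hq : q.totalDegree ≤ m)
    (h : ∀ P ∈ nonzerosIn X ℓ, eval P q = 0) : q = 0 := by
  have h0 : ℓ * q = 0 := by
    refine hX.2 _ ((totalDegree_mul _ _).trans ?_) fun P hP => ?_
    · rw [show ℓ.totalDegree = 1 from hℓ]
      omega
    · by_cases hPℓ : eval P ℓ = 0
      · simp [hPℓ]
      · simp [h P (mem_nonzerosIn.2 ⟨hP, hPℓ⟩)]
  exact (mul_eq_zero.1 h0).resolve_left hℓ.ne_zero

/-- A line passes through at most `n+1` nodes of an `n`-correct set. -/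
lemma IsNCorrect.card_zerosIn_le {n : ℕ} {X : Finset Pt} (hX : IsNCorrect n X) {ℓ : Poly2}
    (hℓ : IsLine ℓ) : (zerosIn X ℓ).card ≤ n + 1 := by
  rcases n with _ | m
  · exact (card_filter_le _ _).trans (by rw [hX.1]; simp [Nn])
  · by_contra! hlt
    have hc := card_zerosIn_add_card_nonzerosIn X ℓ
    rw [hX.1, Nn_succ] at hc
    obtain ⟨q, hq0, hq, hv⟩ :=
      exists_ne_zero_vanishing (m := m) (S := nonzerosIn X ℓ) (by omega)
    exact hq0 (hX.eq_zero_of_nonzerosIn hℓ hq hv)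

/-- Removing a maximal line from an `(m+1)`-correct set leaves an `m`-correct set. -/
lemma IsNCorrect.nonzerosIn {m : ℕ} {X : Finset Pt} (hX : IsNCorrect (m + 1) X) {ℓ : Poly2}
    (hℓ : IsMaximalLine (m + 1) X ℓ) : IsNCorrect m (nonzerosIn X ℓ) := by
  refine ⟨?_, fun q hq h => hX.eq_zero_of_nonzerosIn hℓ.1 hq h⟩
  have hc := card_zerosIn_add_card_nonzerosIn X ℓ
  rw [hX.1, Nn_succ, hℓ.2] at hc
  omega

/-- Two maximal lines meet at a node. -/
lemma IsNCorrect.exists_common_node {m : ℕ} {X : Finset Pt} (hX : IsNCorrect (m + 1) X)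
    {ℓ ℓ' : Poly2} (hℓ : IsMaximalLine (m + 1) X ℓ) (hℓ' : IsMaximalLine (m + 1) X ℓ') :
    ∃ P ∈ X, eval P ℓ = 0 ∧ eval P ℓ' = 0 := by
  by_contra! h
  have hle := (hX.nonzerosIn hℓ).card_zerosIn_le hℓ'.1
  have hsub : zerosIn X ℓ' ⊆ zerosIn (_root_.nonzerosIn X ℓ) ℓ' := fun P hP => by
    rw [mem_zerosIn] at hP
    rw [mem_zerosIn, mem_nonzerosIn]
    exact ⟨⟨hP.1, fun h0 => h P hP.1 h0 hP.2⟩, hP.2⟩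
  have := card_le_card hsub
  rw [hℓ'.2] at this
  omega

/-- A maximal line stays maximal after the removal of a different maximal line. -/
lemma IsMaximalLine.nonzerosIn {m : ℕ} {X : Finset Pt} (hX : IsNCorrect (m + 1) X)
    {ℓ ℓ' : Poly2} (hℓ : IsMaximalLine (m + 1) X ℓ) (hℓ' : IsMaximalLine (m + 1) X ℓ')
    (hne : zeroSet ℓ ≠ zeroSet ℓ') : IsMaximalLine m (nonzerosIn X ℓ) ℓ' := by
  obtain ⟨P, hP, h, h'⟩ := hX.exists_common_node hℓ hℓ'
  refine ⟨hℓ'.1, ?_⟩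
  have heq : zerosIn (_root_.nonzerosIn X ℓ) ℓ' = (zerosIn X ℓ').erase P := by
    ext Q
    rw [mem_erase, mem_zerosIn, mem_zerosIn, mem_nonzerosIn]
    refine ⟨fun hQ => ⟨?_, hQ.1.1, hQ.2⟩, fun hQ => ⟨⟨hQ.2.1, fun h0 => hQ.1 ?_⟩, hQ.2.2⟩⟩
    · rintro rfl
      exact hQ.1.2 h
    · exact hℓ.1.eq_of_zeroSet_ne hℓ'.1 hne h0 hQ.2.2 h h'
  rw [heq, card_erase_of_mem (mem_zerosIn.2 ⟨hP, h'⟩), hℓ'.2]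
  omega

/-- No three different maximal lines are concurrent. -/
lemma IsNCorrect.not_concurrent {m : ℕ} {X : Finset Pt} (hX : IsNCorrect (m + 1) X)
    {ℓ ℓ' ℓ'' : Poly2} (hℓ : IsMaximalLine (m + 1) X ℓ) (hℓ' : IsMaximalLine (m + 1) X ℓ')
    (hℓ'' : IsMaximalLine (m + 1) X ℓ'') (h : zeroSet ℓ ≠ zeroSet ℓ')
    (h' : zeroSet ℓ ≠ zeroSet ℓ'') (h'' : zeroSet ℓ' ≠ zeroSet ℓ'') (P : Pt)
    (hP : eval P ℓ = 0) (hP' : eval P ℓ' = 0) (hP'' : eval P ℓ'' = 0) : False := by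
  have hY := hX.nonzerosIn hℓ
  have h1 := hℓ.nonzerosIn hX hℓ' h
  have h2 := hℓ.nonzerosIn hX hℓ'' h'
  obtain ⟨Q, hQ, hQ', hQ''⟩ : ∃ Q ∈ _root_.nonzerosIn X ℓ, eval Q ℓ' = 0 ∧ eval Q ℓ'' = 0 := by
    rcases m with _ | k
    · have hall : ∀ q, IsMaximalLine 0 (_root_.nonzerosIn X ℓ) q →
          zerosIn (_root_.nonzerosIn X ℓ) q = _root_.nonzerosIn X ℓ := fun q hq =>
        eq_of_subset_of_card_le (filter_subset _ _) (by rw [hY.1, hq.2]; simp [Nn])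
      obtain ⟨Q, hQ⟩ : (_root_.nonzerosIn X ℓ).Nonempty := by
        rw [← card_pos, hY.1]
        simp [Nn]
      exact ⟨Q, hQ, (mem_zerosIn.1 ((hall _ h1).symm ▸ hQ)).2,
        (mem_zerosIn.1 ((hall _ h2).symm ▸ hQ)).2⟩
    · exact hY.exists_common_node h1 h2
  obtain rfl := h1.1.eq_of_zeroSet_ne h2.1 h'' hP' hP'' hQ' hQ''
  exact (mem_nonzerosIn.1 hQ).2 hP

/-- Any `n+1` different maximal lines cover all nodes of an `n`-correct set. -/
lemma IsNCorrect.exists_mem_of_maximalLines {n : ℕ} {X : Finset Pt} (hX : IsNCorrect n X)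
    {ℓ : Fin (n + 1) → Poly2} (hℓ : ∀ i, IsMaximalLine n X (ℓ i))
    (hinj : Function.Injective fun i => zeroSet (ℓ i)) {P : Pt} (hP : P ∈ X) :
    ∃ i, eval P (ℓ i) = 0 := by
  induction n generalizing X with
  | zero =>
    have heq : zerosIn X (ℓ 0) = X :=
      eq_of_subset_of_card_le (filter_subset _ _) (by rw [hX.1, (hℓ 0).2]; simp [Nn])
    exact ⟨0, (mem_zerosIn.1 (heq.symm ▸ hP)).2⟩
  | succ m ih =>
    by_cases h0 : eval P (ℓ 0) = 0
    · exact ⟨0, h0⟩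
    · obtain ⟨i, hi⟩ := ih (hX.nonzerosIn (hℓ 0)) (ℓ := fun i => ℓ i.succ)
        (fun i => (hℓ 0).nonzerosIn hX (hℓ i.succ) (hinj.ne (Fin.succ_ne_zero i).symm))
        (hinj.comp (Fin.succ_injective _)) (mem_nonzerosIn.2 ⟨hP, h0⟩)
      exact ⟨_, hi⟩

lemma ncard_maximalLines_zero_ne_one {X : Finset Pt} (hX : IsNCorrect 0 X) :
    (maximalLines 0 X).ncard ≠ 1 := by
  intro h
  obtain ⟨P, rfl⟩ := card_eq_one.1 (show X.card = 1 by rw [hX.1]; simp [Nn])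
  obtain ⟨Z, hZ⟩ := Set.ncard_eq_one.1 h
  have hmem : ∀ i, zeroSet (MvPolynomial.X i - C (P i)) = Z := fun i => by
    have : zeroSet (MvPolynomial.X i - C (P i)) ∈ maximalLines 0 {P} :=
      ⟨_, ⟨isLine_X_sub_C i _, by simp [zerosIn, filter_singleton]⟩, rfl⟩
    rwa [hZ] at this
  have hQ : (![P 0, P 1 + 1] : Pt) ∈ zeroSet (MvPolynomial.X 0 - C (P 0)) := by simp [zeroSet]
  rw [hmem 0, ← hmem 1] at hQ
  simp [zeroSet] at hQ

lemma not_isCarnicerGasca_zero (X : Finset Pt) : ¬ IsCarnicerGasca 0 X := by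
  rintro ⟨ℓ, A, -, -, h, -⟩
  refine h ⟨MvPolynomial.X 0 - C (A 0 0), isLine_X_sub_C _ _, fun i => ?_⟩
  obtain rfl := Fin.fin_one_eq_zero i
  simp

lemma IsCarnicerGasca.ncard_maximalLines {m : ℕ} {X : Finset Pt} (hX : IsNCorrect (m + 1) X)
    (h : IsCarnicerGasca (m + 1) X) : (maximalLines (m + 1) X).ncard = m + 1 + 1 := by
  obtain ⟨ℓ, A, ⟨hline, hmeet, hconc⟩, hA, hcol, hXeq⟩ := h
  have hmem : ∀ P, P ∈ X ↔ (∃ i j, i ≠ j ∧ eval P (ℓ i) = 0 ∧ eval P (ℓ j) = 0) ∨ ∃ i, A i = P := by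
    intro P
    rw [← mem_coe, hXeq]
    rfl
  have hinj : Function.Injective fun i => zeroSet (ℓ i) := by
    intro i j hij
    have : A i ∈ zeroSet (ℓ i) := (hA i i).2 rfl
    have hj : A i ∈ zeroSet (ℓ j) := by rwa [← show zeroSet (ℓ i) = zeroSet (ℓ j) from hij]
    exact ((hA i j).1 hj).symm
  have hmax : ∀ i, IsMaximalLine (m + 1) X (ℓ i) := by
    intro i
    refine ⟨hline i, le_antisymm (hX.card_zerosIn_le (hline i)) ?_⟩
    have hex : ∀ j, ∃ P, eval P (ℓ i) = 0 ∧ eval P (ℓ j) = 0 ∧ (j = i → P = A i) := fun j => by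
      by_cases hj : j = i
      · subst hj
        exact ⟨A j, (hA j j).2 rfl, (hA j j).2 rfl, fun _ => rfl⟩
      · obtain ⟨P, hP, -⟩ := hmeet i j (Ne.symm hj)
        exact ⟨P, hP.1, hP.2, fun h => absurd h hj⟩
    choose P hPi hPj hPA using hex
    have hPX : ∀ j, P j ∈ zerosIn X (ℓ i) := fun j => by
      refine mem_zerosIn.2 ⟨(hmem _).2 ?_, hPi j⟩
      by_cases hj : j = i
      · exact Or.inr ⟨i, (hPA j hj).symm⟩
      · exact Or.inl ⟨i, j, Ne.symm hj, hPi j, hPj j⟩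
    have hPinj : Function.Injective P := by
      intro j k hjk
      by_cases hj : j = i
      · have hk := hPj k
        rw [← hjk, hPA j hj] at hk
        rw [hj, (hA i k).1 hk]
      · by_cases hk : k = i
        · have hj' := hPj j
          rw [hjk, hPA k hk] at hj'
          rw [hk, (hA i j).1 hj']
        · by_contra hne
          exact hconc i j k (Ne.symm hj) (Ne.symm hk) hne
            ⟨P j, hPi j, hPj j, hjk ▸ hPj k⟩
    simpa using card_le_card_of_injOn (s := univ) P (fun j _ => hPX j) hPinj.injOn
  have heq : maximalLines (m + 1) X = Set.range fun i => zeroSet (ℓ i) := by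
    ext Z
    constructor
    · rintro ⟨L, hL, rfl⟩
      by_contra hZ
      have hne : ∀ i, zeroSet (ℓ i) ≠ zeroSet L := fun i hi => hZ ⟨i, hi⟩
      refine hcol ⟨L, hL.1, fun i => ?_⟩
      obtain ⟨Q, hQ, hQi, hQL⟩ := hX.exists_common_node (hmax i) hL
      have honly : ∀ j, eval Q (ℓ j) = 0 → j = i := by
        intro j hj
        by_contra hji
        exact hX.not_concurrent (hmax j) (hmax i) hL (hinj.ne hji) (hne j) (hne i) Q hj hQi hQL
      rcases (hmem Q).1 hQ with ⟨j, k, hjk, hj, hk⟩ | ⟨j, rfl⟩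
      · exact absurd ((honly j hj).trans (honly k hk).symm) hjk
      · rwa [← honly j ((hA j j).2 rfl)]
    · rintro ⟨i, rfl⟩
      exact ⟨ℓ i, hmax i, rfl⟩
  rw [heq, ← Set.image_univ, Set.ncard_image_of_injective _ hinj]
  simp

lemma isCarnicerGasca_of_ncard_maximalLines {m : ℕ} {X : Finset Pt} (hX : IsNCorrect (m + 1) X)
    (h : (maximalLines (m + 1) X).ncard = m + 1 + 1) : IsCarnicerGasca (m + 1) X := by
  have hfin : (maximalLines (m + 1) X).Finite := Set.finite_of_ncard_ne_zero (by omega)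
  have := hfin.to_subtype
  let e : Fin (m + 1 + 1) ≃ maximalLines (m + 1) X :=
    (Finite.equivFinOfCardEq (by rw [Nat.card_coe_set_eq, h])).symm
  choose ℓ hmax hℓ using fun i => (e i).2
  have hinj : Function.Injective fun i => zeroSet (ℓ i) := by
    intro i j hij
    apply e.injective
    rw [Subtype.ext_iff, hℓ i, hℓ j]
    exact hij
  have huniq : ∀ {i j}, i ≠ j → ∀ {P Q : Pt}, eval P (ℓ i) = 0 → eval P (ℓ j) = 0 →
      eval Q (ℓ i) = 0 → eval Q (ℓ j) = 0 → P = Q := fun hij _ _ h1 h2 h3 h4 =>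
    (hmax _).1.eq_of_zeroSet_ne (hmax _).1 (hinj.ne hij) h1 h2 h3 h4
  have hconc : ∀ i j k, i ≠ j → i ≠ k → j ≠ k →
      ¬∃ P : Pt, eval P (ℓ i) = 0 ∧ eval P (ℓ j) = 0 ∧ eval P (ℓ k) = 0 := by
    rintro i j k hij hik hjk ⟨P, hi, hj, hk⟩
    exact hX.not_concurrent (hmax i) (hmax j) (hmax k) (hinj.ne hij) (hinj.ne hik) (hinj.ne hjk)
      P hi hj hk
  choose N hNX hN hN' using fun i j => hX.exists_common_node (hmax i) (hmax j)
  have hA : ∀ i, ∃ A, zerosIn X (ℓ i) \ (univ.erase i).image (N i) = {A} := by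
    intro i
    rw [← card_eq_one, card_sdiff_of_subset, (hmax i).2, card_image_of_injOn]
    · simp
    · intro j hj k hk hjk
      simp only [coe_erase, coe_univ, Set.mem_sdiff, Set.mem_univ, Set.mem_singleton_iff,
        true_and] at hj hk
      by_contra hne
      exact hconc i j k (Ne.symm hj) (Ne.symm hk) hne ⟨N i j, hN i j, hN' i j, by
        rw [show N i j = N i k from hjk]; exact hN' i k⟩
    · intro P hP
      obtain ⟨j, -, rfl⟩ := mem_image.1 hP
      exact mem_zerosIn.2 ⟨hNX i j, hN i j⟩
  choose A hA using hA
  have hAiff : ∀ i P, P = A i ↔ (P ∈ X ∧ eval P (ℓ i) = 0) ∧ ∀ j, j ≠ i → eval P (ℓ j) ≠ 0 := by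
    intro i P
    rw [← mem_singleton, ← hA i, mem_sdiff, mem_zerosIn]
    refine and_congr_right fun hP => ⟨fun h j hj h0 => h ?_, fun h hmem => ?_⟩
    · exact mem_image.2 ⟨j, by simpa using hj,
        huniq (Ne.symm hj) (hN i j) (hN' i j) hP.2 h0⟩
    · obtain ⟨j, hj, rfl⟩ := mem_image.1 hmem
      exact h j (by simpa using hj) (hN' i j)
  have hAX : ∀ i, A i ∈ X := fun i => ((hAiff i _).1 rfl).1.1
  have hAℓ : ∀ i j, eval (A i) (ℓ j) = 0 ↔ j = i := by
    intro i j
    have hi := (hAiff i _).1 rfl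
    refine ⟨fun h0 => by_contra fun hj => hi.2 j hj h0, ?_⟩
    rintro rfl
    exact hi.1.2
  refine ⟨ℓ, A, ⟨fun i => (hmax i).1, fun i j hij => ?_, hconc⟩, hAℓ, ?_, ?_⟩
  · exact ⟨N i j, ⟨hN i j, hN' i j⟩, fun P hP => huniq hij hP.1 hP.2 (hN i j) (hN' i j)⟩
  · rintro ⟨L, hL, hAL⟩
    have hAinj : Function.Injective A := fun i j hij =>
      ((hAℓ i j).1 (hij ▸ (hAℓ j j).2 rfl)).symm
    have hLmax : IsMaximalLine (m + 1) X L := by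
      refine ⟨hL, le_antisymm (hX.card_zerosIn_le hL) ?_⟩
      simpa using card_le_card_of_injOn (s := univ) A
        (fun i _ => mem_zerosIn.2 ⟨hAX i, hAL i⟩) hAinj.injOn
    obtain ⟨i, hi⟩ := e.surjective ⟨zeroSet L, L, hLmax, rfl⟩
    have hLi : zeroSet (ℓ i) = zeroSet L := by rw [← hℓ i, hi]
    obtain ⟨j, hj⟩ := exists_ne i
    have hmem : A j ∈ zeroSet (ℓ i) := by
      rw [hLi]
      exact hAL j
    exact hj ((hAℓ j i).1 hmem).symm
  · ext P
    simp only [mem_coe, Set.mem_union, Set.mem_ofPred_eq, Set.mem_range]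
    constructor
    · intro hP
      obtain ⟨i, hi⟩ := hX.exists_mem_of_maximalLines hmax hinj hP
      by_cases hj : ∃ j, j ≠ i ∧ eval P (ℓ j) = 0
      · obtain ⟨j, hji, hj⟩ := hj
        exact Or.inl ⟨i, j, Ne.symm hji, hi, hj⟩
      · push Not at hj
        exact Or.inr ⟨i, ((hAiff i P).2 ⟨⟨hP, hi⟩, hj⟩).symm⟩
    · rintro (⟨i, j, hij, hi, hj⟩ | ⟨i, rfl⟩)
      · rw [huniq hij hi hj (hN i j) (hN' i j)]
        exact hNX i j
      · exact hAX i

/-- an `n`-correct set has exactly `n+1` maximal lines iff it is a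
Carnicer–Gasca set of degree `n`. -/
theorem carnicer_gasca_iff_max_lines (n : ℕ) (X : Finset Pt) (hX : IsNCorrect n X) :
    (maximalLines n X).ncard = n + 1 ↔ IsCarnicerGasca n X := by
  rcases n with _ | m
  · exact iff_of_false (ncard_maximalLines_zero_ne_one hX) (not_isCarnicerGasca_zero X)
  · exact ⟨isCarnicerGasca_of_ncard_maximalLines hX, fun h => h.ncard_maximalLines hX⟩
end
end

section
/- Let X be an n-correct set and let A, B, C₁, C₂ ∈ X be such that both {A,B,C₁} and {A,B,C₂} are special triplets. Then C₁ = C₂. -/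
open MvPolynomial Finset
open scoped Classical BigOperators

noncomputable section

/-- The oriented area form of `P`, `Q`, `R` as an affine polynomial in `R`. -/
def linePoly (P Q : Pt) : Poly2 :=
  C (Q 1 - P 1) * (X 0 - C (P 0)) - C (Q 0 - P 0) * (X 1 - C (P 1))

theorem eval_linePoly (P Q R : Pt) :
    eval R (linePoly P Q) = (Q 1 - P 1) * (R 0 - P 0) - (Q 0 - P 0) * (R 1 - P 1) := by
  simp [linePoly]

theorem totalDegree_linePoly_le (P Q : Pt) : (linePoly P Q).totalDegree ≤ 1 := by
  have h (a b : ℝ) (i : Fin 2) : (C a * (X i - C b) : Poly2).totalDegree ≤ 1 := by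
    refine (totalDegree_mul _ _).trans ?_
    have := totalDegree_sub_C_le (X i : Poly2) b
    rw [totalDegree_X] at this
    simpa using this
  exact (totalDegree_sub _ _).trans (max_le (h _ _ _) (h _ _ _))

theorem eval_eq_zero_of_nonzerosIn_eq {X S : Finset Pt} {f : Poly2} (h : nonzerosIn X f = S)
    {P : Pt} (hP : P ∈ X) (hPS : P ∉ S) : eval P f = 0 := by
  by_contra h0
  exact hPS (h ▸ Finset.mem_filter.2 ⟨hP, h0⟩)

theorem eval_ne_zero_of_nonzerosIn_eq {X S : Finset Pt} {f : Poly2} (h : nonzerosIn X f = S)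
    {P : Pt} (hPS : P ∈ S) : eval P f ≠ 0 := by
  rw [← h] at hPS
  exact (Finset.mem_filter.1 hPS).2

theorem IsSpecialTriplet.one_le {n : ℕ} {X : Finset Pt} (hX : IsNCorrect n X) {A B C : Pt}
    (h : IsSpecialTriplet n X A B C) : 1 ≤ n := by
  rcases n with _ | n
  · have h1 : X.card = 1 := by simpa [Nn] using hX.1
    exact absurd (Finset.card_le_one.1 h1.le A h.1 B h.2.1) h.2.2.2.1
  · omega

/-- The complement of a maximal curve of degree `n - 1` is not collinear. -/
theorem not_collinear_of_nonzerosIn_eq {n : ℕ} {X : Finset Pt} (hX : IsNCorrect n X)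
    {A B C : Pt} {f : Poly2} (hAB : A ≠ B) (hf : f.totalDegree + 1 ≤ n)
    (h : nonzerosIn X f = {A, B, C}) : eval C (linePoly A B) ≠ 0 := by
  intro hC
  have h0 : f * linePoly A B = 0 := by
    refine hX.2 _ ((totalDegree_mul _ _).trans
      ((Nat.add_le_add_left (totalDegree_linePoly_le A B) _).trans hf)) fun P hP => ?_
    by_cases hPS : P ∈ ({A, B, C} : Finset Pt)
    · simp only [Finset.mem_insert, Finset.mem_singleton] at hPS
      rw [map_mul]
      rcases hPS with rfl | rfl | rfl
      · rw [eval_linePoly]; ring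
      · rw [eval_linePoly]; ring
      · rw [hC, mul_zero]
    · rw [map_mul, eval_eq_zero_of_nonzerosIn_eq h hP hPS, zero_mul]
  rcases mul_eq_zero.1 h0 with h0 | h0
  · exact eval_ne_zero_of_nonzerosIn_eq h (P := A) (by simp) (by simp [h0])
  · apply hAB
    have e0 := congrArg (eval ![A 0 + (B 1 - A 1), A 1 - (B 0 - A 0)]) h0
    rw [eval_linePoly] at e0
    simp only [Matrix.cons_val_zero, Matrix.cons_val_one, map_zero] at e0
    ext i
    fin_cases i
    · simp only [Fin.zero_eta]
      nlinarith [sq_nonneg (B 1 - A 1), sq_nonneg (B 0 - A 0)]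
    · simp only [Fin.mk_one]
      nlinarith [sq_nonneg (B 1 - A 1), sq_nonneg (B 0 - A 0)]

/-- Multiplying the two curves by the lines joining `A` to `C₁` and `C₂` gives proportional
polynomials. -/
theorem curve_mul_linePoly_proportional {n : ℕ} {X : Finset Pt} (hX : IsNCorrect n X)
    {A B C₁ C₂ : Pt} {f₁ f₂ : Poly2}
    (hf₁ : f₁.totalDegree + 1 ≤ n) (hf₂ : f₂.totalDegree + 1 ≤ n)
    (hC₁ : eval C₁ f₂ = 0) (hC₂ : eval C₂ f₁ = 0)
    (h₁ : nonzerosIn X f₁ = {A, B, C₁}) (h₂ : nonzerosIn X f₂ = {A, B, C₂}) :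
    C (eval B (f₂ * linePoly A C₂)) * (f₁ * linePoly A C₁) =
      C (eval B (f₁ * linePoly A C₁)) * (f₂ * linePoly A C₂) := by
  have hdeg (c : ℝ) {f : Poly2} (hf : f.totalDegree + 1 ≤ n) (P Q : Pt) :
      (C c * (f * linePoly P Q)).totalDegree ≤ n := by
    refine (totalDegree_mul _ _).trans ?_
    rw [totalDegree_C, zero_add]
    exact (totalDegree_mul _ _).trans
      ((Nat.add_le_add_left (totalDegree_linePoly_le P Q) _).trans hf)
  refine sub_eq_zero.1 (hX.2 _ ((totalDegree_sub _ _).trans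
    (max_le (hdeg _ hf₁ _ _) (hdeg _ hf₂ _ _))) fun P hP => ?_)
  simp only [map_sub, map_mul, eval_C]
  have hl (Q : Pt) : eval A (linePoly A Q) = 0 ∧ eval Q (linePoly A Q) = 0 := by
    constructor <;> rw [eval_linePoly] <;> ring
  by_cases hA : P = A
  · subst hA; rw [(hl _).1, (hl _).1]; ring
  by_cases hB : P = B
  · subst hB; ring
  by_cases h1 : P = C₁
  · subst h1; rw [(hl _).2, hC₁]; ring
  by_cases h2 : P = C₂
  · subst h2; rw [(hl _).2, hC₂]; ring
  rw [eval_eq_zero_of_nonzerosIn_eq h₁ hP (by simp [*]),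
    eval_eq_zero_of_nonzerosIn_eq h₂ hP (by simp [*])]
  ring

theorem linePoly_perm (P Q R : Pt) :
    eval Q (linePoly P R) = - eval R (linePoly P Q) ∧
      eval P (linePoly Q R) = eval R (linePoly P Q) := by
  simp only [eval_linePoly]
  constructor <;> ring

/-- If the products of opposite joining lines are proportional, then `C₁ = C₂`. -/
theorem eq_of_linePoly_mul_proportional {A B C₁ C₂ : Pt} {a b : ℝ} (ha : a ≠ 0) (hb : b ≠ 0)
    (hC₁ : eval C₁ (linePoly A B) ≠ 0)
    (h : C a * (linePoly A C₁ * linePoly B C₂) = C b * (linePoly A C₂ * linePoly B C₁)) :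
    C₁ = C₂ := by
  have hA := congrArg (eval ![(A 0 + C₁ 0) / 2, (A 1 + C₁ 1) / 2]) h
  have hB := congrArg (eval ![(B 0 + C₁ 0) / 2, (B 1 + C₁ 1) / 2]) h
  simp only [map_mul, eval_C, eval_linePoly, Matrix.cons_val_zero, Matrix.cons_val_one]
    at hA hB hC₁
  have eA : (C₂ 1 - A 1) * (C₁ 0 - A 0) - (C₂ 0 - A 0) * (C₁ 1 - A 1) = 0 := by
    refine (mul_eq_zero.1 (?_ : _ * (b * ((B 1 - A 1) * (C₁ 0 - A 0) -
      (B 0 - A 0) * (C₁ 1 - A 1))) = 0)).resolve_right (mul_ne_zero hb hC₁)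
    linear_combination -4 * hA
  have eB : (C₂ 1 - B 1) * (C₁ 0 - B 0) - (C₂ 0 - B 0) * (C₁ 1 - B 1) = 0 := by
    refine (mul_eq_zero.1 (?_ : _ * (a * ((B 1 - A 1) * (C₁ 0 - A 0) -
      (B 0 - A 0) * (C₁ 1 - A 1))) = 0)).resolve_right (mul_ne_zero ha hC₁)
    linear_combination -4 * hB
  ext i
  refine sub_eq_zero.1 ((mul_eq_zero.1 ?_).resolve_right hC₁)
  fin_cases i
  · simp only [Fin.zero_eta]
    linear_combination (C₁ 0 - B 0) * eA - (C₁ 0 - A 0) * eB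
  · simp only [Fin.mk_one]
    linear_combination (C₁ 1 - B 1) * eA - (C₁ 1 - A 1) * eB

/-- two special triplets of an `n`-correct set sharing two nodes coincide. -/
theorem special_triplet_unique (n : ℕ) (X : Finset Pt) (hX : IsNCorrect n X)
    (A B C₁ C₂ : Pt)
    (h₁ : IsSpecialTriplet n X A B C₁) (h₂ : IsSpecialTriplet n X A B C₂) :
    C₁ = C₂ := by
  have hn := h₁.one_le hX
  obtain ⟨-, -, hC₁, hAB, hAC₁, hBC₁, f₁, ⟨hd₁, -⟩, e₁⟩ := h₁
  obtain ⟨-, -, hC₂, -, hAC₂, hBC₂, f₂, ⟨hd₂, -⟩, e₂⟩ := h₂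
  by_contra hne
  have hf₁ : f₁.totalDegree + 1 ≤ n := by omega
  have hf₂ : f₂.totalDegree + 1 ≤ n := by omega
  have z₁ : eval C₁ f₂ = 0 :=
    eval_eq_zero_of_nonzerosIn_eq e₂ hC₁ (by simp [hAC₁.symm, hBC₁.symm, hne])
  have z₂ : eval C₂ f₁ = 0 :=
    eval_eq_zero_of_nonzerosIn_eq e₁ hC₂ (by simp [hAC₂.symm, hBC₂.symm, Ne.symm hne])
  have l₁ := not_collinear_of_nonzerosIn_eq hX hAB hf₁ e₁
  have l₂ := not_collinear_of_nonzerosIn_eq hX hAB hf₂ e₂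
  have pA := curve_mul_linePoly_proportional hX hf₁ hf₂ z₁ z₂ e₁ e₂
  have pB := curve_mul_linePoly_proportional hX hf₁ hf₂ z₁ z₂
    (e₁.trans (Finset.insert_comm _ _ _)) (e₂.trans (Finset.insert_comm _ _ _))
  have nA₁ := eval_ne_zero_of_nonzerosIn_eq e₁ (P := A) (by simp)
  have nB₁ := eval_ne_zero_of_nonzerosIn_eq e₁ (P := B) (by simp)
  have nA₂ := eval_ne_zero_of_nonzerosIn_eq e₂ (P := A) (by simp)
  have nB₂ := eval_ne_zero_of_nonzerosIn_eq e₂ (P := B) (by simp)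
  have h0 : f₁ * f₂ ≠ 0 := by
    refine mul_ne_zero ?_ ?_ <;> rintro rfl
    · simp at nA₁
    · simp at nA₂
  refine hne (eq_of_linePoly_mul_proportional
    (a := eval B (f₂ * linePoly A C₂) * eval A (f₁ * linePoly B C₁))
    (b := eval B (f₁ * linePoly A C₁) * eval A (f₂ * linePoly B C₂)) ?_ ?_ l₁
    (mul_left_cancel₀ h0 ?_))
  · rw [map_mul, map_mul, (linePoly_perm A B C₂).1, (linePoly_perm A B C₁).2]
    exact mul_ne_zero (mul_ne_zero nB₂ (neg_ne_zero.2 l₂)) (mul_ne_zero nA₁ l₁)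
  · rw [map_mul, map_mul, (linePoly_perm A B C₁).1, (linePoly_perm A B C₂).2]
    exact mul_ne_zero (mul_ne_zero nB₁ (neg_ne_zero.2 l₁)) (mul_ne_zero nA₂ l₂)
  · simp only [C_mul]
    generalize eval B (f₂ * linePoly A C₂) = u₁ at *
    generalize eval B (f₁ * linePoly A C₁) = u₂ at *
    generalize eval A (f₁ * linePoly B C₁) = v₁ at *
    generalize eval A (f₂ * linePoly B C₂) = v₂ at *
    linear_combination (C v₁ * (f₂ * linePoly B C₂)) * pA -
      (C u₂ * (f₂ * linePoly A C₂)) * pB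
end
end

section
/- Let X be an n-correct set, let A, B, C ∈ X, and suppose ℓ_{AB} is a 2-node line of X (it contains exactly the nodes A and B of X) which is used by the node C, i.e., p*_C = ℓ_{AB}·f with f of degree n−1. Then {A,B,C} is a special triplet of X and f is its associated maximal curve of degree n−1. -/
open MvPolynomial Finset
open scoped Classical BigOperators

noncomputable section

/-- Two distinct points of the plane lie on a common line. -/
theorem exists_line_through {P Q : Pt} (h : P ≠ Q) :
    ∃ m : Poly2, m ≠ 0 ∧ m.totalDegree ≤ 1 ∧ eval P m = 0 ∧ eval Q m = 0 := by
  refine ⟨C (Q 1 - P 1) * (X 0 - C (P 0)) - C (Q 0 - P 0) * (X 1 - C (P 1)), ?_, ?_, ?_, ?_⟩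
  · intro h0
    have h1 := congrArg (eval ![P 0 + (Q 1 - P 1), P 1 - (Q 0 - P 0)]) h0
    simp only [map_sub, map_mul, eval_C, eval_X, map_zero, Matrix.cons_val_zero,
      Matrix.cons_val_one] at h1
    apply h
    ext i
    fin_cases i
    · change P 0 = Q 0
      nlinarith [sq_nonneg (Q 1 - P 1), sq_nonneg (Q 0 - P 0)]
    · change P 1 = Q 1
      nlinarith [sq_nonneg (Q 1 - P 1), sq_nonneg (Q 0 - P 0)]
  · have hdeg : ∀ (a b : ℝ) (i : Fin 2),
        (C a * (X i - C b) : Poly2).totalDegree ≤ 1 := by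
      intro a b i
      refine (totalDegree_mul _ _).trans ?_
      rw [totalDegree_C, zero_add]
      refine (totalDegree_sub _ _).trans ?_
      simp [totalDegree_X, totalDegree_C]
    exact (totalDegree_sub _ _).trans (max_le (hdeg _ _ _) (hdeg _ _ _))
  · simp
  · simp only [map_sub, map_mul, eval_C, eval_X]
    ring

/-- A nonzero polynomial of degree less than `n` cannot vanish at all but two nodes of an
`n`-correct set. -/
theorem IsNCorrect.eq_zero_of_vanish_off_pair {n : ℕ} {X : Finset Pt} (hX : IsNCorrect n X)
    {P Q : Pt} (hPQ : P ≠ Q) {f : Poly2} (hf : f.totalDegree + 1 ≤ n)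
    (hv : ∀ R ∈ X, R ≠ P → R ≠ Q → eval R f = 0) : f = 0 := by
  obtain ⟨m, hm, hdeg, hP, hQ⟩ := exists_line_through hPQ
  have h0 : m * f = 0 := by
    refine hX.2 _ ((totalDegree_mul _ _).trans (by omega)) fun R hR => ?_
    rw [map_mul]
    by_cases h1 : R = P
    · rw [h1, hP, zero_mul]
    by_cases h2 : R = Q
    · rw [h2, hQ, zero_mul]
    rw [hv R hR h1 h2, mul_zero]
  exact (mul_eq_zero.mp h0).resolve_left hm

/-- `N = d(n,n-1) + 3` for `n ≥ 1`. -/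
theorem Nn_eq_d_pred_add_three {n : ℕ} (hn : 1 ≤ n) : Nn n = d n (n - 1) + 3 := by
  obtain ⟨k, rfl⟩ := Nat.exists_eq_add_of_le' hn
  have h1 : 2 * (k + 1) + 3 - (k + 1 - 1) = k + 5 := by omega
  have h2 : (k + 1 + 1) * (k + 1 + 2) = k * (k + 5) + 3 * 2 := by ring
  rw [Nn, d, h1, h2, Nat.add_mul_div_right _ _ two_pos, Nat.add_sub_cancel]

/-- if the `2`-node line `ℓ_{AB}` of the `n`-correct set `X` is used by the
node `C`, i.e. `p*_C = ℓ_{AB}·f` with `deg f = n-1`, then `{A,B,C}` is a special triplet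
and `f` is its associated maximal curve of degree `n-1`. -/
theorem two_node_line_gives_special_triplet (n : ℕ) (X : Finset Pt) (hX : IsNCorrect n X)
    (A B C : Pt) (hA : A ∈ X) (hB : B ∈ X) (hC : C ∈ X)
    (ℓ f : Poly2) (h2 : IsTwoNodeLineOf X ℓ A B)
    (hf : f.totalDegree = n - 1)
    (hfund : IsFund n X C (ℓ * f)) :
    IsSpecialTriplet n X A B C ∧ IsMaximalCurve n (n - 1) X f ∧
      nonzerosIn X f = {A, B, C} := by
  obtain ⟨-, hAB, hzero⟩ := h2
  obtain ⟨-, hC1, hvan⟩ := hfund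
  have hmem : ∀ P ∈ X, eval P ℓ = 0 → P = A ∨ P = B := by
    intro P hP h
    have : P ∈ zerosIn X ℓ := mem_filter.mpr ⟨hP, h⟩
    simpa [hzero] using this
  have hℓA : eval A ℓ = 0 := by
    have : A ∈ zerosIn X ℓ := by simp [hzero]
    exact (mem_filter.mp this).2
  have hℓB : eval B ℓ = 0 := by
    have : B ∈ zerosIn X ℓ := by simp [hzero]
    exact (mem_filter.mp this).2
  rw [map_mul] at hC1
  have hℓC : eval C ℓ ≠ 0 := left_ne_zero_of_mul_eq_one hC1
  have hfC : eval C f ≠ 0 := right_ne_zero_of_mul_eq_one hC1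
  have hAC : A ≠ C := by rintro rfl; exact hℓC hℓA
  have hBC : B ≠ C := by rintro rfl; exact hℓC hℓB
  have hf0 : f ≠ 0 := by rintro rfl; simp at hfC
  have hoff : ∀ P ∈ X, P ≠ A → P ≠ B → P ≠ C → eval P f = 0 := by
    intro P hP h1 h2 h3
    have h := hvan P hP h3
    rw [map_mul] at h
    exact (mul_eq_zero.mp h).resolve_left fun h0 => (hmem P hP h0).elim h1 h2
  have hn : 1 ≤ n := by
    by_contra! h
    obtain rfl : n = 0 := by omega
    exact hAB (card_le_one.mp hX.1.le A hA B hB)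
  have hdeg : f.totalDegree + 1 ≤ n := by omega
  have hfA : eval A f ≠ 0 := fun h => hf0 <|
    hX.eq_zero_of_vanish_off_pair hBC hdeg fun R hR h1 h2 => by
      by_cases h3 : R = A
      · rwa [h3]
      · exact hoff R hR h3 h1 h2
  have hfB : eval B f ≠ 0 := fun h => hf0 <|
    hX.eq_zero_of_vanish_off_pair hAC hdeg fun R hR h1 h2 => by
      by_cases h3 : R = B
      · rwa [h3]
      · exact hoff R hR h1 h3 h2
  have hnon : nonzerosIn X f = {A, B, C} := by
    ext P
    simp only [nonzerosIn, mem_filter, mem_insert, mem_singleton]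
    constructor
    · rintro ⟨hP, h⟩
      by_contra! h'
      exact h (hoff P hP h'.1 h'.2.1 h'.2.2)
    · rintro (rfl | rfl | rfl)
      exacts [⟨hA, hfA⟩, ⟨hB, hfB⟩, ⟨hC, hfC⟩]
  have hmax : IsMaximalCurve n (n - 1) X f := by
    refine ⟨hf, ?_⟩
    have hcard : (zerosIn X f).card + (nonzerosIn X f).card = X.card :=
      card_filter_add_card_filter_not _
    rw [hnon, card_eq_three.mpr ⟨A, B, C, hAB, hAC, hBC, rfl⟩, hX.1,
      Nn_eq_d_pred_add_three hn] at hcard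
    omega
  exact ⟨⟨hA, hB, hC, hAB, hAC, hBC, f, hmax, hnon⟩, hmax, hnon⟩
end
end
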